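/- Let N ∈ ℕ, let Ψ: ℝ^N → [0,∞) be convex with Ψ(ξ) ≤ C₂(1 + ‖ξ‖) for all ξ ∈ ℝ^N (C₂ > 0), and let φ: ℝ^N → [0,∞) be a smooth, compactly supported function. Then the convolution φ * Ψ, defined by (φ * Ψ)(ξ) = ∫_{ℝ^N} φ(ξ − ζ) Ψ(ζ) dζ, is a smooth convex function, and for all ξ ∈ ℝ^N and all i, j ∈ {1, …, N} its second partial derivatives satisfy |∂²(φ * Ψ)/∂ξ_i ∂ξ_j (ξ)| ≤ 2 C₂ · (diam supp φ)^{N−1} · (sup φ). In particular, the second derivative of φ * Ψ is uniformly bounded on ℝ^N. -/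

import Mathlib

open Set MeasureTheory

noncomputable section

lemma cvx {E : Type*} [NormedAddCommGroup E] [NormedSpace ℝ E] {F : E → ℝ} (hF : ConvexOn ℝ Set.univ F)
    (x y : E) (a b : ℝ) (ha : 0 ≤ a) (hb : 0 ≤ b) (hab : a + b = 1) :
    F (a • x + b • y) ≤ a • F x + b • F y := hF.2 (mem_univ x) (mem_univ y) ha hb hab

lemma oneD (g : ℝ → ℝ) (C : ℝ) (hg : Continuous g) (hL : ∀ s t, |g s - g t| ≤ C * |s - t|) (a b h : ℝ) :
    ∫ t in a..b, (g (t+h) + g (t-h) - 2 * g t) ≤ 2 * C * h^2 := by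
  set p : ℝ → ℝ := fun t => g (t+h) - g t with hp
  have hpc : Continuous p := by fun_prop
  have hpi : ∀ a b, IntervalIntegrable p volume a b := fun a b => hpc.intervalIntegrable a b
  have e : ∀ t, g (t+h) + g (t-h) - 2 * g t = p t - p (t-h) := by
    intro t; simp only [hp, sub_add_cancel]; ring
  have hb : ∀ t, ‖p t‖ ≤ C * |h| := by
    intro t; have := hL (t+h) t; simpa [hp] using this
  simp_rw [e]
  rw [intervalIntegral.integral_sub (hpi _ _) ((by fun_prop : Continuous fun t => p (t-h)).intervalIntegrable a b),
    intervalIntegral.integral_comp_sub_right,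
    intervalIntegral.integral_interval_sub_interval_comm (hpi _ _) (hpi _ _) (hpi _ _)]
  have h1 := intervalIntegral.norm_integral_le_of_norm_le_const (f := p) (a := a) (b := a - h) (C := C * |h|) (fun x _ => hb x)
  have h2 := intervalIntegral.norm_integral_le_of_norm_le_const (f := p) (a := b) (b := b - h) (C := C * |h|) (fun x _ => hb x)
  rw [Real.norm_eq_abs] at h1 h2
  have e1 : |a - h - a| = |h| := by rw [show a - h - a = -h by ring, abs_neg]
  have e2 : |b - h - b| = |h| := by rw [show b - h - b = -h by ring, abs_neg]
  rw [e1, mul_assoc, abs_mul_abs_self] at h1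
  rw [e2, mul_assoc, abs_mul_abs_self] at h2
  have := (abs_le.1 h1).2
  have := (abs_le.1 h2).1
  linarith [(abs_le.1 h1).2,(abs_le.1 h2).1]

lemma lip {E : Type*} [NormedAddCommGroup E] [NormedSpace ℝ E] (Ψ : E → ℝ) (hΨconv : ConvexOn ℝ Set.univ Ψ)
    (hΨnn : ∀ ξ, 0 ≤ Ψ ξ)
    (C₂ : ℝ) (hC₂ : 0 < C₂)
    (hgrowth : ∀ ξ, Ψ ξ ≤ C₂ * (1 + ‖ξ‖)) (x v : E) : Ψ (x+v) - Ψ x ≤ C₂ * ‖v‖ := by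
  have key : ∀ s : ℝ, 1 ≤ s → s * (Ψ (x+v) - Ψ x - C₂ * ‖v‖) ≤ C₂ * (1 + ‖x‖) := by
    intro s hs
    have s0 : 0 < s := by linarith
    have h1 := cvx hΨconv x (x + s • v) (1 - 1/s) (1/s)
      (by rw [sub_nonneg, div_le_one s0]; exact hs) (by positivity) (by ring)
    have e : (1 - 1/s) • x + (1/s) • (x + s • v) = x + v := by
      rw [smul_add, smul_smul, one_div_mul_cancel s0.ne', sub_smul, one_smul, one_smul]; abel
    rw [e, smul_eq_mul, smul_eq_mul] at h1
    have h2 := hgrowth (x + s • v)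
    have h3 : ‖x + s • v‖ ≤ ‖x‖ + s * ‖v‖ := by
      refine (norm_add_le _ _).trans ?_
      rw [norm_smul, Real.norm_of_nonneg s0.le]
    have h4 : s * Ψ (x+v) ≤ (s - 1) * Ψ x + Ψ (x + s • v) := by
      have := mul_le_mul_of_nonneg_left h1 s0.le
      refine this.trans (le_of_eq ?_)
      field_simp
    have h5 := hΨnn x
    have h6 := mul_le_mul_of_nonneg_left h3 hC₂.le
    nlinarith
  by_contra! hc
  set d := Ψ (x+v) - Ψ x - C₂ * ‖v‖ with hd
  have d0 : 0 < d := by linarith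
  have := key (1 + C₂ * (1 + ‖x‖) / d) (by have : 0 ≤ C₂ * (1 + ‖x‖) / d := by positivity
                                           linarith)
  have e : (1 + C₂ * (1 + ‖x‖) / d) * d = d + C₂ * (1 + ‖x‖) := by field_simp
  linarith

lemma secmin (K : ℝ → ℝ) (hK : ContDiff ℝ 2 K) (h0 : K 0 = 0) (hp : ∀ t, 0 ≤ K t) :
    0 ≤ deriv (deriv K) 0 := by
  by_contra! hc
  have hm : IsLocalMin K 0 := Filter.Eventually.of_forall (fun t => by rw [h0]; exact hp t)
  have hM := isLocalMax_of_deriv_deriv_neg hc hm.deriv_eq_zero hK.continuous.continuousAt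
  have : K =ᶠ[nhds 0] fun _ => 0 := by
    filter_upwards [hM] with t ht
    exact le_antisymm (h0 ▸ ht) (hp t)
  have := this.deriv.deriv_eq
  simp at this
  linarith

lemma secbound {E : Type*} [NormedAddCommGroup E] [NormedSpace ℝ E] (f : E → ℝ) (hf : ContDiff ℝ (⊤ : ℕ∞) f)
    (ξ u : E) (M c : ℝ) (hM : ∀ h : ℝ, 0 ≤ M * h^2 + c * (f (ξ + h • u) + f (ξ - h • u) - 2 * f ξ)) :
    0 ≤ M + c * fderiv ℝ (fun y => fderiv ℝ f y u) ξ u := by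
  have d1 : ∀ (F : E → ℝ) (hF : Differentiable ℝ F) (v : E) (t : ℝ), HasDerivAt (fun t : ℝ => F (ξ + t • v)) (fderiv ℝ F (ξ + t • v) v) t := by
    intro F hF v t
    have h1 : HasDerivAt (fun t : ℝ => ξ + t • v) v t := by
      simpa using ((hasDerivAt_id t).smul_const v).const_add ξ
    exact (hF _).hasFDerivAt.comp_hasDerivAt t h1
  have hf1 : Differentiable ℝ f := hf.differentiable (by simp)
  have hf2 : ContDiff ℝ (⊤ : ℕ∞) (fun y => fderiv ℝ f y u) := 
    (hf.fderiv_right (by simp)).clm_apply contDiff_const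
  have hf3 : Differentiable ℝ (fun y => fderiv ℝ f y u) := hf2.differentiable (by simp)
  set K : ℝ → ℝ := fun h => M * h^2 + c * (f (ξ + h • u) + f (ξ + h • (-u)) - 2 * f ξ) with hK
  have k1 : deriv K = fun h => 2 * M * h + c * (fderiv ℝ f (ξ + h • u) u - fderiv ℝ f (ξ + h • (-u)) u) := by
    funext h
    have := (((hasDerivAt_id h).pow 2).const_mul M).add ((((d1 f hf1 u h).add (d1 f hf1 (-u) h)).sub_const (2 * f ξ)).const_mul c)
    refine HasDerivAt.deriv (this.congr_deriv ?_)
    simp; ring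
  have k2 : deriv (deriv K) 0 = 2 * (M + c * fderiv ℝ (fun y => fderiv ℝ f y u) ξ u) := by
    rw [k1]
    have := ((hasDerivAt_id (0:ℝ)).const_mul (2 * M)).add (((d1 _ hf3 u 0).sub (d1 _ hf3 (-u) 0)).const_mul c)
    refine HasDerivAt.deriv (this.congr_deriv ?_)
    simp; ring
  have hf' : ContDiff ℝ 2 f := contDiff_infty.1 hf 2
  have := secmin K (by simp only [hK]; fun_prop) (by simp [hK]; right; ring) (by intro t; have := hM t; simpa [hK, sub_eq_add_neg] using this)
  linarith

lemma box_bound (n : ℕ) (i : Fin (n+1)) (Q : EuclideanSpace ℝ (Fin (n+1)) → ℝ) (hQ : Continuous Q)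
    (a : Fin (n+1) → ℝ) (D K : ℝ) (hD : 0 ≤ D)
    (hin : ∀ y : Fin n → ℝ, ∫ t in (a i)..(a i + D), Q (WithLp.toLp 2 (i.insertNth t y)) ≤ K) :
    ∫ z in {z : EuclideanSpace ℝ (Fin (n+1)) | ∀ k, z k ∈ Icc (a k) (a k + D)}, Q z ≤ K * D^n := by
  set A : Set ℝ := Icc (a i) (a i + D)
  set B : Set (Fin n → ℝ) := Icc (fun k => a (i.succAbove k)) (fun k => a (i.succAbove k) + D)
  have e1 := (PiLp.volume_preserving_toLp (Fin (n+1))).setIntegral_preimage_emb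
    (MeasurableEquiv.toLp 2 (Fin (n+1) → ℝ)).measurableEmbedding Q {z : EuclideanSpace ℝ (Fin (n+1)) | ∀ k, z k ∈ Icc (a k) (a k + D)}
  have e2 := ((volume_preserving_piFinSuccAbove (fun _ : Fin (n+1) => ℝ) i).symm).setIntegral_preimage_emb
    (MeasurableEquiv.piFinSuccAbove (fun _ => ℝ) i).symm.measurableEmbedding (fun x => Q (WithLp.toLp 2 x)) {z : (Fin (n+1)) → ℝ | ∀ k, z k ∈ Icc (a k) (a k + D)}
  rw [← e1]
  change ∫ x in {z : (Fin (n+1)) → ℝ | ∀ k, z k ∈ Icc (a k) (a k + D)}, Q (WithLp.toLp 2 x) ≤ _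
  rw [← e2]
  have hs : (MeasurableEquiv.piFinSuccAbove (fun _ : Fin (n+1) => ℝ) i).symm ⁻¹' {z : (Fin (n+1)) → ℝ | ∀ k, z k ∈ Icc (a k) (a k + D)} = A ×ˢ B := by
    ext ⟨t, y⟩
    change (∀ k, (i.insertNth t y : Fin (n+1) → ℝ) k ∈ Icc (a k) (a k + D)) ↔ t ∈ A ∧ y ∈ B
    rw [Fin.forall_iff_succAbove i]
    simp [A, B, Pi.le_def, forall_and]
  rw [hs]
  change ∫ x in A ×ˢ B, Q (WithLp.toLp 2 (i.insertNth x.1 x.2 : Fin (n+1) → ℝ)) ≤ _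
  have hc : Continuous (fun x : ℝ × (Fin n → ℝ) => Q (WithLp.toLp 2 (i.insertNth x.1 x.2 : Fin (n+1) → ℝ))) := by
    refine hQ.comp ((PiLp.continuous_toLp 2 _).comp ?_)
    exact Continuous.finInsertNth i continuous_fst continuous_snd
  rw [Measure.volume_eq_prod, ← setIntegral_prod_swap]
  have hc2 : Continuous (fun x : (Fin n → ℝ) × ℝ => Q (WithLp.toLp 2 (i.insertNth x.2 x.1 : Fin (n+1) → ℝ))) := hc.comp continuous_swap
  have hint : IntegrableOn (fun x : (Fin n → ℝ) × ℝ => Q (WithLp.toLp 2 (i.insertNth x.2 x.1 : Fin (n+1) → ℝ))) (B ×ˢ A) (volume.prod volume) :=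
    hc2.continuousOn.integrableOn_compact (isCompact_Icc.prod isCompact_Icc)
  change ∫ x in B ×ˢ A, Q (WithLp.toLp 2 (i.insertNth x.2 x.1 : Fin (n+1) → ℝ)) ∂(volume.prod volume) ≤ _
  rw [setIntegral_prod _ hint]
  have hvol : volume.real B = D^n := by
    simp only [B, Measure.real, Real.volume_Icc_pi]
    simp [hD]
  have hBf : volume B ≠ ⊤ := isCompact_Icc.measure_lt_top.ne
  calc _ ≤ ∫ y in B, K := by
        refine setIntegral_mono ?_ ?_ ?_
        · rw [IntegrableOn, ← Measure.prod_restrict] at hint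
          exact hint.integral_prod_left
        · exact integrableOn_const hBf
        · intro y
          have := hin y
          rw [intervalIntegral.integral_of_le (by linarith), ← integral_Icc_eq_integral_Ioc] at this
          exact this
    _ = K * D^n := by rw [setIntegral_const, hvol, smul_eq_mul, mul_comm]

theorem second_derivative_bound_of_mollified_convex {N : ℕ}
    (Ψ : EuclideanSpace ℝ (Fin N) → ℝ) (hΨconv : ConvexOn ℝ Set.univ Ψ)
    (hΨnn : ∀ ξ, 0 ≤ Ψ ξ)
    (C₂ : ℝ) (hC₂ : 0 < C₂)
    (hgrowth : ∀ ξ, Ψ ξ ≤ C₂ * (1 + ‖ξ‖))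
    (φ : EuclideanSpace ℝ (Fin N) → ℝ) (hφsm : ContDiff ℝ (⊤ : ℕ∞) φ)
    (hφsupp : HasCompactSupport φ) (hφnn : ∀ x, 0 ≤ φ x) :
    ContDiff ℝ (⊤ : ℕ∞) (fun ξ => ∫ ζ, φ (ξ - ζ) * Ψ ζ) ∧
    ConvexOn ℝ Set.univ (fun ξ => ∫ ζ, φ (ξ - ζ) * Ψ ζ) ∧
    ∀ ξ : EuclideanSpace ℝ (Fin N), ∀ i j : Fin N,
      |fderiv ℝ (fun y => fderiv ℝ (fun ξ' => ∫ ζ, φ (ξ' - ζ) * Ψ ζ) y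
          (EuclideanSpace.single j 1)) ξ (EuclideanSpace.single i 1)| ≤
        2 * C₂ * Metric.diam (tsupport φ) ^ (N - 1) * (⨆ x, φ x) := by
  have hlip := lip Ψ hΨconv hΨnn C₂ hC₂ hgrowth
  have hlip2 : ∀ x y, |Ψ x - Ψ y| ≤ C₂ * ‖x - y‖ := by
    intro x y
    rw [abs_le]
    have h1 := hlip x (y - x)
    have h2 := hlip y (x - y)
    rw [add_sub_cancel] at h1 h2
    rw [norm_sub_rev] at h1
    constructor <;> linarith
  have hΨc : Continuous Ψ := by
    refine (LipschitzWith.of_dist_le_mul (K := C₂.toNNReal) fun x y => ?_).continuous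
    rw [Real.dist_eq, dist_eq_norm, Real.coe_toNNReal _ hC₂.le]
    exact hlip2 x y
  have hφc : Continuous φ := hφsm.continuous
  set f : EuclideanSpace ℝ (Fin N) → ℝ := fun ξ => ∫ ζ, φ (ξ - ζ) * Ψ ζ with hf
  have hfe : ∀ ξ, f ξ = ∫ z, φ z * Ψ (ξ - z) := by
    intro ξ
    rw [← integral_sub_left_eq_self _ _ ξ]
    simp [hf]
  have hI : ∀ ξ, Integrable (fun z => φ z * Ψ (ξ - z)) := by
    intro ξ
    exact (by fun_prop : Continuous (fun z => φ z * Ψ (ξ - z))).integrable_of_hasCompactSupport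
      hφsupp.mul_right
  have hsm : ContDiff ℝ (⊤ : ℕ∞) f := by
    have := HasCompactSupport.contDiff_convolution_right (μ := volume) (ContinuousLinearMap.mul ℝ ℝ) hφsupp
      (hΨc.locallyIntegrable) hφsm
    convert this using 1
    funext ξ
    simp only [hf, convolution_def, ContinuousLinearMap.mul_apply']
    simp_rw [mul_comm]
  have hcv : ConvexOn ℝ Set.univ f := by
    refine ⟨convex_univ, fun x _ y _ a b ha hb hab => ?_⟩
    rw [hfe, hfe, hfe, smul_eq_mul, smul_eq_mul, ← integral_const_mul, ← integral_const_mul,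
      ← integral_add ((hI x).const_mul a) ((hI y).const_mul b)]
    refine integral_mono (hI _) (((hI x).const_mul a).add ((hI y).const_mul b)) fun z => ?_
    have h1 := cvx hΨconv (x - z) (y - z) a b ha hb hab
    have e : a • (x - z) + b • (y - z) = a • x + b • y - z := by
      rw [smul_sub, smul_sub]
      nth_rewrite 3 [← one_smul ℝ z]
      rw [← hab, add_smul]; abel
    rw [e, smul_eq_mul, smul_eq_mul] at h1
    have := mul_le_mul_of_nonneg_left h1 (hφnn z)
    simp only
    linarith
  refine ⟨hsm, hcv, fun ξ i j => ?_⟩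
  set S := ⨆ x, φ x with hS
  set D := Metric.diam (tsupport φ) with hD
  set M := 2 * C₂ * D ^ (N - 1) * S with hM
  have hφS : ∀ x, φ x ≤ S := fun x => le_ciSup (hφc.bddAbove_range_of_hasCompactSupport hφsupp) x
  have hS0 : 0 ≤ S := (hφnn 0).trans (hφS 0)
  have hD0 : 0 ≤ D := Metric.diam_nonneg
  have mid : ∀ (F : EuclideanSpace ℝ (Fin N) → ℝ), ConvexOn ℝ Set.univ F → ∀ x u, 0 ≤ F (x + u) + F (x - u) - 2 * F x := by
    intro F hF x u
    have h1 := cvx hF (x + u) (x - u) (1/2) (1/2) (by norm_num) (by norm_num) (by norm_num)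
    have e : (1/2 : ℝ) • (x + u) + (1/2 : ℝ) • (x - u) = x := by
      module
    rw [e, smul_eq_mul, smul_eq_mul] at h1
    linarith
  have hnn : ∀ u, 0 ≤ fderiv ℝ (fun y => fderiv ℝ f y u) ξ u := by
    intro u
    have := secbound f hsm ξ u 0 1 (fun h => by simpa using mid f hcv ξ (h • u))
    simpa using this
  have hup : ∀ i : Fin N, fderiv ℝ (fun y => fderiv ℝ f y (EuclideanSpace.single i 1)) ξ (EuclideanSpace.single i 1) ≤ M := by
    intro i
    set e : EuclideanSpace ℝ (Fin N) := EuclideanSpace.single i 1 with he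
    have hen : ‖e‖ = 1 := by simp [he]
    suffices hh : ∀ h : ℝ, f (ξ + h • e) + f (ξ - h • e) - 2 * f ξ ≤ M * h^2 by
      have := secbound f hsm ξ e M (-1) (fun h => by have := hh h; linarith)
      linarith
    intro h
    set Q : EuclideanSpace ℝ (Fin N) → ℝ := fun z => Ψ (ξ - z + h • e) + Ψ (ξ - z - h • e) - 2 * Ψ (ξ - z) with hQ
    have hQc : Continuous Q := by fun_prop
    have hQ0 : ∀ z, 0 ≤ Q z := fun z => mid Ψ hΨconv _ _
    have e1 : f (ξ + h • e) + f (ξ - h • e) - 2 * f ξ = ∫ z, φ z * Q z := by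
      rw [hfe, hfe, hfe, ← integral_const_mul, ← integral_add (hI _) (hI _),
        ← integral_sub (f := fun z => φ z * Ψ (ξ + h • e - z) + φ z * Ψ (ξ - h • e - z))
          ((hI _).add (hI _)) ((hI _).const_mul 2)]
      congr 1
      funext z
      simp only [hQ]
      rw [show ξ + h • e - z = ξ - z + h • e by abel, show ξ - h • e - z = ξ - z - h • e by abel]
      ring
    rw [e1]
    set a : Fin N → ℝ := fun k => sInf ((fun z : EuclideanSpace ℝ (Fin N) => z k) '' tsupport φ) with ha
    set box : Set (EuclideanSpace ℝ (Fin N)) := {z | ∀ k, z k ∈ Icc (a k) (a k + D)} with hbox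
    have hsub : tsupport φ ⊆ box := by
      intro z hz k
      have hco : Continuous (fun z : EuclideanSpace ℝ (Fin N) => z k) := by fun_prop
      have hbd : BddBelow ((fun z : EuclideanSpace ℝ (Fin N) => z k) '' tsupport φ) :=
        (hφsupp.isCompact.image hco).bddBelow
      refine ⟨csInf_le hbd ⟨z, hz, rfl⟩, ?_⟩
      have : z k - D ≤ a k := by
        refine le_csInf ⟨_, z, hz, rfl⟩ ?_
        rintro _ ⟨w, hw, rfl⟩
        have h1 : dist z w ≤ D := Metric.dist_le_diam_of_mem hφsupp.isCompact.isBounded hz hw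
        have h2 : |z k - w k| ≤ dist z w := by
          rw [dist_eq_norm]
          simpa using PiLp.norm_apply_le (z - w) k
        have := (abs_le.1 h2).2
        simp only
        linarith
      linarith
    have hboxeq : box = (WithLp.ofLp ⁻¹' (Icc a (fun k => a k + D)) : Set (EuclideanSpace ℝ (Fin N))) := by
      ext z
      change (∀ k, z k ∈ Icc (a k) (a k + D)) ↔ (WithLp.ofLp z) ∈ Icc a (fun k => a k + D)
      simp [Pi.le_def, forall_and]
    have hboxc : IsCompact box := by
      rw [hboxeq]
      exact (PiLp.homeomorph 2 (fun _ : Fin N => ℝ)).isCompact_preimage.2 isCompact_Icc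
    have hb : ∫ z in box, Q z ≤ 2 * C₂ * h^2 * D^(N-1) := by
      obtain ⟨n, rfl⟩ : ∃ n, N = n + 1 := ⟨N - 1, by have := i.pos; omega⟩
      refine box_bound n i Q hQc a D _ hD0 fun y => ?_
      set w : EuclideanSpace ℝ (Fin (n+1)) := ξ - WithLp.toLp 2 (i.insertNth (0:ℝ) y : Fin (n+1) → ℝ) with hw
      have hins : ∀ t : ℝ, ξ - WithLp.toLp 2 (i.insertNth t y : Fin (n+1) → ℝ) = w - t • e := by
        intro t
        rw [hw, sub_sub]
        congr 1
        ext k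
        refine Fin.succAboveCases i ?_ (fun k => ?_) k <;> simp [he]
      have := oneD (fun t => Ψ (w - t • e)) C₂ (by fun_prop) (fun s t => by
        refine (hlip2 _ _).trans (le_of_eq ?_)
        rw [show w - s • e - (w - t • e) = (t - s) • e by module, norm_smul, hen, mul_one, Real.norm_eq_abs, abs_sub_comm])
        (a i) (a i + D) h
      refine le_trans (le_of_eq ?_) this
      congr 1
      funext t
      simp only [hQ, hins]
      rw [show w - t • e + h • e = w - (t - h) • e by module, show w - t • e - h • e = w - (t + h) • e by module]
      ring
    have hQi : IntegrableOn Q box := hQc.continuousOn.integrableOn_compact hboxc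
    calc ∫ z, φ z * Q z = ∫ z in box, φ z * Q z := by
          rw [setIntegral_eq_integral_of_forall_compl_eq_zero]
          intro z hz
          rw [image_eq_zero_of_notMem_tsupport (fun hh => hz (hsub hh)), zero_mul]
      _ ≤ ∫ z in box, S * Q z := by
          refine setIntegral_mono ((hφc.mul hQc).continuousOn.integrableOn_compact hboxc) (hQi.const_mul S) fun z => ?_
          exact mul_le_mul_of_nonneg_right (hφS z) (hQ0 z)
      _ = S * ∫ z in box, Q z := integral_const_mul _ _
      _ ≤ S * (2 * C₂ * h^2 * D^(N-1)) := mul_le_mul_of_nonneg_left hb hS0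
      _ = M * h^2 := by rw [hM]; ring
  have hd2 : DifferentiableAt ℝ (fderiv ℝ f) ξ :=
    ((hsm.fderiv_right (m := (⊤ : ℕ∞)) (by simp)).differentiable (by simp)) ξ
  have hB : ∀ u v, fderiv ℝ (fun y => fderiv ℝ f y u) ξ v = fderiv ℝ (fderiv ℝ f) ξ v u := by
    intro u v
    have := (hd2.hasFDerivAt.clm_apply (hasFDerivAt_const u ξ)).fderiv
    rw [this]; simp
  have hsymm : IsSymmSndFDerivAt ℝ f ξ :=
    hsm.contDiffAt.isSymmSndFDerivAt (by
      rw [minSmoothness_of_isRCLikeNormedField]; exact WithTop.coe_le_coe.2 le_top)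
  simp_rw [hB] at hnn hup ⊢
  have hi := hup i
  have hj := hup j
  have hp := hnn (EuclideanSpace.single i 1 + EuclideanSpace.single j 1)
  have hm := hnn (EuclideanSpace.single i 1 - EuclideanSpace.single j 1)
  have hs := hsymm (EuclideanSpace.single i 1) (EuclideanSpace.single j 1)
  simp only [map_add, map_sub, add_apply, sub_apply] at hp hm
  rw [abs_le]
  constructor <;> linarith
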